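/- If μ is a probability measure on [0,∞) whose Laplace transform satisfies ∫_0^∞ e^{−θs} μ(ds) = exp(−Γ(1−α)θ^α) for all θ ≥ 0, then ∫_0^∞ s^{−α} μ(ds) = 1/(Γ(1+α)Γ(1−α)). -/

import Mathlib

open MeasureTheory Filter Real

/-- The Gamma integral `∫₀^∞ θ^(a-1) e^{-θr} dθ = r^{-a} Γ(a)` as a Lebesgue integral. -/
lemma lintegral_rpow_mul_exp_neg_mul_Ioi {a r : ℝ} (ha : 0 < a) (hr : 0 < r) :
    ∫⁻ θ in Set.Ioi (0 : ℝ), ENNReal.ofReal (θ ^ (a - 1)) * ENNReal.ofReal (exp (-(θ * r)))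
      = ENNReal.ofReal (Gamma a) * ENNReal.ofReal (r ^ (-a)) := by
  have hint : IntegrableOn (fun θ : ℝ => θ ^ (a - 1) * exp (-(r * θ))) (Set.Ioi 0) := by
    simpa using integrableOn_rpow_mul_exp_neg_mul_rpow (p := 1) (s := a - 1) (b := r)
      (by linarith) one_pos hr
  have hnn : 0 ≤ᵐ[volume.restrict (Set.Ioi (0 : ℝ))]
      fun θ : ℝ => θ ^ (a - 1) * exp (-(r * θ)) := by
    filter_upwards [ae_restrict_mem measurableSet_Ioi] with θ hθ
    exact mul_nonneg (rpow_nonneg (le_of_lt hθ) _) (exp_nonneg _)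
  rw [← ENNReal.ofReal_mul (Gamma_pos_of_pos ha).le, mul_comm (Gamma a), rpow_neg hr.le,
    ← inv_rpow hr.le, ← one_div, ← integral_rpow_mul_exp_neg_mul_Ioi ha hr,
    ofReal_integral_eq_lintegral_ofReal hint hnn]
  refine setLIntegral_congr_fun measurableSet_Ioi fun θ hθ => ?_
  rw [← ENNReal.ofReal_mul (rpow_nonneg (le_of_lt hθ) _), mul_comm θ r]

/-- The integral `∫₀^∞ θ^(a-1) e^{-cθ^a} dθ = 1/(a c)` as a Lebesgue integral. -/
lemma lintegral_rpow_sub_one_mul_exp_neg_mul_rpow {a c : ℝ} (ha : 0 < a) (hc : 0 < c) :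
    ∫⁻ θ in Set.Ioi (0 : ℝ), ENNReal.ofReal (θ ^ (a - 1)) * ENNReal.ofReal (exp (-(c * θ ^ a)))
      = ENNReal.ofReal ((a * c)⁻¹) := by
  have hint := integrableOn_rpow_mul_exp_neg_mul_rpow (s := a - 1) (by linarith) ha hc
  have hval := integral_rpow_mul_exp_neg_mul_rpow (q := a - 1) ha (by linarith) hc
  have hnn : 0 ≤ᵐ[volume.restrict (Set.Ioi (0 : ℝ))]
      fun θ : ℝ => θ ^ (a - 1) * exp (-c * θ ^ a) := by
    filter_upwards [ae_restrict_mem measurableSet_Ioi] with θ hθ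
    exact mul_nonneg (rpow_nonneg (le_of_lt hθ) _) (exp_nonneg _)
  have hexp : c ^ (-(a - 1 + 1) / a) * (1 / a) * Gamma ((a - 1 + 1) / a) = (a * c)⁻¹ := by
    rw [sub_add_cancel, neg_div, div_self ha.ne', Gamma_one, rpow_neg_one]
    field_simp
  rw [← hexp, ← hval, ofReal_integral_eq_lintegral_ofReal hint hnn]
  refine setLIntegral_congr_fun measurableSet_Ioi fun θ hθ => ?_
  rw [← ENNReal.ofReal_mul (rpow_nonneg (le_of_lt hθ) _), neg_mul]

/-- **Lemma.** If `μ` is a probability measure on `[0,∞)` whose Laplace transform is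
`∫ e^{−θs} μ(ds) = exp(−Γ(1−α)θ^α)` for all `θ ≥ 0` (the one-sided `α`-stable law), then
`∫ s^{−α} μ(ds) = 1/(Γ(1+α)Γ(1−α))`. -/
theorem stable_law_negative_moment
    (α : ℝ) (hα : α ∈ Set.Ioo (0:ℝ) 1)
    (μ : Measure ℝ) [IsProbabilityMeasure μ]
    (hsupp : μ {s | s < 0} = 0)
    (hLaplace : ∀ θ : ℝ, 0 ≤ θ →
      ∫ s, Real.exp (-(θ * s)) ∂μ = Real.exp (-(Real.Gamma (1 - α) * θ ^ α))) :
    ∫⁻ s, ENNReal.ofReal (s ^ (-α : ℝ)) ∂μ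
      = ENNReal.ofReal ((Real.Gamma (1 + α) * Real.Gamma (1 - α))⁻¹) := by
  obtain ⟨h0, h1⟩ := hα
  have hc : 0 < Gamma (1 - α) := Gamma_pos_of_pos (by linarith)
  have hΓ : 0 < Gamma α := Gamma_pos_of_pos h0
  have hL : ∀ θ : ℝ, 0 ≤ θ → ∫⁻ s, ENNReal.ofReal (exp (-(θ * s))) ∂μ
      = ENNReal.ofReal (exp (-(Gamma (1 - α) * θ ^ α))) := by
    intro θ hθ
    have hint : Integrable (fun s => exp (-(θ * s))) μ := by
      by_contra h
      have := hLaplace θ hθ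
      rw [integral_undef h] at this
      exact (exp_pos _).ne this
    rw [← hLaplace θ hθ,
      ofReal_integral_eq_lintegral_ofReal hint (ae_of_all _ fun s => (exp_pos _).le)]
  have hzero : μ {0} = 0 := by
    have hle : ∀ θ : ℝ, 0 ≤ θ → μ {0} ≤ ENNReal.ofReal (exp (-(Gamma (1 - α) * θ ^ α))) := by
      intro θ hθ
      rw [← hL θ hθ]
      calc μ {0} = ∫⁻ s in {0}, ENNReal.ofReal (exp (-(θ * s))) ∂μ := by simp
        _ ≤ _ := setLIntegral_le_lintegral _ _
    have hlim : Tendsto (fun θ : ℝ => ENNReal.ofReal (exp (-(Gamma (1 - α) * θ ^ α))))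
        atTop (nhds 0) := by
      rw [← ENNReal.ofReal_zero]
      exact ENNReal.tendsto_ofReal (tendsto_exp_neg_atTop_nhds_zero.comp
        ((tendsto_rpow_atTop h0).const_mul_atTop hc))
    exact le_antisymm (ge_of_tendsto hlim ((eventually_ge_atTop 0).mono hle)) zero_le
  have hpos : ∀ᵐ s ∂μ, 0 < s := by
    have h₁ : ∀ᵐ s ∂μ, ¬ s < 0 := measure_eq_zero_iff_ae_notMem.mp hsupp
    have h₂ : ∀ᵐ s ∂μ, s ∉ ({0} : Set ℝ) := measure_eq_zero_iff_ae_notMem.mp hzero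
    filter_upwards [h₁, h₂] with s hs hs'
    exact lt_of_le_of_ne (not_lt.mp hs) fun h => hs' h.symm
  have key : ENNReal.ofReal (Gamma α) * ∫⁻ s, ENNReal.ofReal (s ^ (-α)) ∂μ
      = ENNReal.ofReal ((α * Gamma (1 - α))⁻¹) := by
    calc ENNReal.ofReal (Gamma α) * ∫⁻ s, ENNReal.ofReal (s ^ (-α)) ∂μ
        = ∫⁻ s, ENNReal.ofReal (Gamma α) * ENNReal.ofReal (s ^ (-α)) ∂μ :=
          (lintegral_const_mul _ (by fun_prop)).symm
      _ = ∫⁻ s, (∫⁻ θ in Set.Ioi (0 : ℝ),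
            ENNReal.ofReal (θ ^ (α - 1)) * ENNReal.ofReal (exp (-(θ * s)))) ∂μ :=
          lintegral_congr_ae <| hpos.mono fun s hs =>
            (lintegral_rpow_mul_exp_neg_mul_Ioi h0 hs).symm
      _ = ∫⁻ θ in Set.Ioi (0 : ℝ), ∫⁻ s,
            ENNReal.ofReal (θ ^ (α - 1)) * ENNReal.ofReal (exp (-(θ * s))) ∂μ :=
          lintegral_lintegral_swap (by fun_prop)
      _ = ∫⁻ θ in Set.Ioi (0 : ℝ),
            ENNReal.ofReal (θ ^ (α - 1)) * ENNReal.ofReal (exp (-(Gamma (1 - α) * θ ^ α))) := by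
          refine setLIntegral_congr_fun measurableSet_Ioi fun θ hθ => ?_
          rw [← hL θ (le_of_lt hθ)]
          exact lintegral_const_mul _ (by fun_prop)
      _ = _ := lintegral_rpow_sub_one_mul_exp_neg_mul_rpow h0 hc
  have hne : ENNReal.ofReal (Gamma α) ≠ 0 := by simpa using hΓ
  rw [← ENNReal.mul_right_inj hne ENNReal.ofReal_ne_top, key, ← ENNReal.ofReal_mul hΓ.le,
    add_comm 1 α, Gamma_add_one h0.ne']
  congr 1
  field_simp
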